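/- Fix real numbers ω and τ with 0 < τ < ω ≤ 1/2. Let (n_j), (w_j), (k_j) be sequences of positive integers with n_j → ∞, w_j/n_j → ω, and k_j/n_j → τ. For each j let S_{k_j} be the (k_j+1)×(k_j+1) symmetric tridiagonal matrix with diagonal entries b_i = (n_j−2w_j)²·i·(n_j−i+1)/(w_j(n_j−w_j)(n_j−2i)(n_j−2i+2)) and off-diagonal entries a_i = [n_j(w_j−i)(n_j−w_j−i)/(w_j(n_j−w_j)(n_j−2i))]·√((i+1)(n_j−i+1)/((n_j−2i+1)(n_j−2i−1))). Then λmax(S_{k_j}) → √(τ(1−τ))·(2ω(1−ω) + √(τ(1−τ))) / (ω(1−ω)(1 + 2√(τ(1−τ)))) as j → ∞. -/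

import Mathlib

/-- Symmetric tridiagonal (k+1)×(k+1) matrix with diagonal `d 0, …, d k` and
off-diagonal `o 0, …, o (k-1)`. -/
noncomputable def Tridiag (k : ℕ) (d o : ℕ → ℝ) : Matrix (Fin (k + 1)) (Fin (k + 1)) ℝ :=
  Matrix.of fun i j =>
    if (i : ℕ) = (j : ℕ) then d i
    else if (i : ℕ) + 1 = (j : ℕ) then o i
    else if (j : ℕ) + 1 = (i : ℕ) then o j
    else 0

/-- The largest eigenvalue of a real square matrix. -/
noncomputable def maxEig {m : ℕ} (M : Matrix (Fin m) (Fin m) ℝ) : ℝ :=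
  sSup {μ : ℝ | Module.End.HasEigenvalue (Matrix.toLin' M) μ}
open Filter

/-- The rescaled diagonal entry of the Hahn matrix. -/
noncomputable def hahnDiag (p x h : ℝ) : ℝ :=
  (1 - 2 * p) ^ 2 * x * (1 - x + h) / (p * (1 - p) * (1 - 2 * x) * (1 - 2 * x + 2 * h))

/-- The rescaled off-diagonal entry of the Hahn matrix. -/
noncomputable def hahnOff (p x h : ℝ) : ℝ :=
  ((p - x) * (1 - p - x) / (p * (1 - p) * (1 - 2 * x))) *
    Real.sqrt (((x + h) * (1 - x + h)) / ((1 - 2 * x + h) * (1 - 2 * x - h)))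

theorem hahnDiag_div {N : ℝ} (hN : N ≠ 0) (W i : ℝ) :
    hahnDiag (W / N) (i / N) (1 / N) =
      (N - 2 * W) ^ 2 * i * (N - i + 1) / (W * (N - W) * (N - 2 * i) * (N - 2 * i + 2)) := by
  rw [hahnDiag, ← mul_div_mul_left _ _ (pow_ne_zero 4 hN)]
  congr 1 <;> field_simp

theorem hahnOff_div {N : ℝ} (hN : N ≠ 0) (W i : ℝ) :
    hahnOff (W / N) (i / N) (1 / N) =
      (N * (W - i) * (N - W - i) / (W * (N - W) * (N - 2 * i))) *
        Real.sqrt ((i + 1) * (N - i + 1) / ((N - 2 * i + 1) * (N - 2 * i - 1))) := by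
  rw [hahnOff, ← mul_div_mul_left _ _ (pow_ne_zero 3 hN),
    ← mul_div_mul_left ((i / N + 1 / N) * _) _ (pow_ne_zero 2 hN)]
  congr 2
  · field_simp
  · field_simp
  · congr 1 <;> field_simp

theorem hahnOff_nonneg {p x h : ℝ} (hx : x ≤ p) (hpx : x ≤ 1 - p) (hp : 0 ≤ p) (hp1 : p ≤ 1)  :
    0 ≤ hahnOff p x h := by
  have h1 : 0 ≤ p - x := by linarith
  have h2 : 0 ≤ 1 - p - x := by linarith
  have h3 : 0 ≤ 1 - p := by linarith
  have h4 : 0 ≤ 1 - 2 * x := by linarith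
  unfold hahnOff
  positivity

theorem hahnOff_neg_step (p h : ℝ) : hahnOff p (-h) h = 0 := by
  simp [hahnOff]

theorem continuousAt_hahnDiag {p x : ℝ} (hp : 0 < p) (hp1 : p < 1) (hx : x < 1 / 2) :
    ContinuousAt (fun z : ℝ × ℝ × ℝ => hahnDiag z.1 z.2.1 z.2.2) (p, x, 0) := by
  have h1 : 1 - p ≠ 0 := by linarith
  have h2 : 1 - 2 * x ≠ 0 := by linarith
  unfold hahnDiag
  refine ContinuousAt.div (by fun_prop) (by fun_prop) ?_
  simp [hp.ne', h1, h2]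

theorem continuousAt_hahnOff {p x : ℝ} (hp : 0 < p) (hp1 : p < 1) (hx : x < 1 / 2) :
    ContinuousAt (fun z : ℝ × ℝ × ℝ => hahnOff z.1 z.2.1 z.2.2) (p, x, 0) := by
  have h1 : 1 - p ≠ 0 := by linarith
  have h2 : 1 - 2 * x ≠ 0 := by linarith
  unfold hahnOff
  refine ContinuousAt.mul (ContinuousAt.div (by fun_prop) (by fun_prop) ?_)
    (ContinuousAt.sqrt (ContinuousAt.div (by fun_prop) (by fun_prop) ?_))
  · simp [hp.ne', h1, h2]
  · simp [h2]

/-- The limiting largest eigenvalue, as a function of `s = √(x (1 - x))` and `q = p (1 - p)`. -/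
noncomputable def hahnLimit (q s : ℝ) : ℝ := s * (2 * q + s) / (q * (1 + 2 * s))

theorem hahnDiag_add_two_mul_hahnOff {p x : ℝ} (hp : 0 < p) (hp1 : p < 1) (hx0 : 0 ≤ x)
    (hx : x < 1 / 2) :
    hahnDiag p x 0 + 2 * hahnOff p x 0 = hahnLimit (p * (1 - p)) (Real.sqrt (x * (1 - x))) := by
  have h1 : 0 < 1 - p := by linarith
  have h2 : 0 < 1 - 2 * x := by linarith
  have hs : Real.sqrt (((x + 0) * (1 - x + 0)) / ((1 - 2 * x + 0) * (1 - 2 * x - 0))) =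
      Real.sqrt (x * (1 - x)) / (1 - 2 * x) := by
    rw [add_zero, add_zero, add_zero, sub_zero, Real.sqrt_div' _ (by positivity),
      Real.sqrt_mul_self h2.le]
  have hx1 : 0 ≤ x * (1 - x) := mul_nonneg hx0 (by linarith)
  rw [hahnDiag, hahnOff, hs, hahnLimit]
  set s := Real.sqrt (x * (1 - x)) with hs_def
  have hs0 : 0 ≤ s := Real.sqrt_nonneg _
  have hs2 : s ^ 2 = x * (1 - x) := Real.sq_sqrt hx1
  have h3 : 1 - 2 * x + 2 * 0 ≠ 0 := by linarith
  have h4 : 1 + 2 * s ≠ 0 := by positivity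
  have hnum : (1 - 2 * p) ^ 2 * x * (1 - x + 0) = (1 - 4 * (p * (1 - p))) * s ^ 2 := by
    rw [hs2]; ring
  have hoff : (p - x) * (1 - p - x) = p * (1 - p) - s ^ 2 := by rw [hs2]; ring
  have hden : (1 - 2 * x) ^ 2 = 1 - 4 * s ^ 2 := by rw [hs2]; ring
  have h5 : 1 - 4 * s ^ 2 ≠ 0 := by rw [← hden]; positivity
  rw [hnum, hoff]
  have key : (1 - 4 * (p * (1 - p))) * s ^ 2 / (p * (1 - p) * (1 - 4 * s ^ 2)) +
      2 * ((p * (1 - p) - s ^ 2) * s / (p * (1 - p) * (1 - 4 * s ^ 2))) =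
      s * (2 * (p * (1 - p)) + s) / (p * (1 - p) * (1 + 2 * s)) := by
    field_simp
    ring
  rw [← key, ← hden]
  field_simp
  ring

theorem hahnLimit_le_hahnLimit {q s t : ℝ} (hq : 0 < q) (hs : 0 ≤ s) (hst : s ≤ t) :
    hahnLimit q s ≤ hahnLimit q t := by
  have ht : 0 ≤ t := hs.trans hst
  unfold hahnLimit
  rw [div_le_div_iff₀ (by positivity) (by positivity)]
  have h : 0 ≤ q * (t - s) * (2 * q + s + t + 2 * s * t) :=
    mul_nonneg (mul_nonneg hq.le (sub_nonneg.2 hst)) (by positivity)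
  nlinarith [h]

theorem hahnLimit_nonneg {q s : ℝ} (hq : 0 < q) (hs : 0 ≤ s) : 0 ≤ hahnLimit q s := by
  unfold hahnLimit
  positivity

theorem continuousAt_hahnLimit {q s : ℝ} (hq : 0 < q) (hs : 0 ≤ s) :
    ContinuousAt (hahnLimit q) s := by
  unfold hahnLimit
  exact ContinuousAt.div (by fun_prop) (by fun_prop) (by positivity)

theorem Tridiag_isHermitian (k : ℕ) (d o : ℕ → ℝ) : (Tridiag k d o).IsHermitian := by
  ext i j
  simp only [Matrix.conjTranspose_apply, Tridiag, Matrix.of_apply, star_trivial]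
  split_ifs <;> first | rfl | omega | simp_all

theorem hasEigenvalue_Tridiag_le {k : ℕ} {d o : ℕ → ℝ} {C μ : ℝ} (h0 : d 0 + |o 0| ≤ C)
    (h : ∀ i < k, d (i + 1) + |o (i + 1)| + |o i| ≤ C)
    (hμ : Module.End.HasEigenvalue (Matrix.toLin' (Tridiag k d o)) μ) : μ ≤ C := by
  obtain ⟨i, hi⟩ := eigenvalue_mem_ball hμ
  rw [mem_closedBall_iff_norm, Real.norm_eq_abs] at hi
  have hdiag : Tridiag k d o i i = d i := by simp [Tridiag]
  rw [hdiag] at hi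
  have hsum : ∑ j ∈ Finset.univ.erase i, ‖Tridiag k d o i j‖ ≤
      ∑ j ∈ Finset.range (k + 1), ((if (i : ℕ) + 1 = j then |o i| else 0) +
        (if j + 1 = (i : ℕ) then |o j| else 0)) := by
    rw [← Fin.sum_univ_eq_sum_range
      (fun j => (if (i : ℕ) + 1 = j then |o i| else 0) + (if j + 1 = (i : ℕ) then |o j| else 0))]
    refine (Finset.sum_le_sum fun j hj => ?_).trans
      (Finset.sum_le_sum_of_subset_of_nonneg (Finset.erase_subset i _) fun j _ _ => ?_)
    · have hij : (i : ℕ) ≠ j := fun e => (Finset.mem_erase.1 hj).1 (Fin.ext e.symm)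
      simp only [Tridiag, Matrix.of_apply, Real.norm_eq_abs, if_neg hij]
      split_ifs <;> simp
    · positivity
  rw [Finset.sum_add_distrib, Finset.sum_ite_eq] at hsum
  have hfst : (if (i : ℕ) + 1 ∈ Finset.range (k + 1) then |o i| else 0) ≤ |o i| := by
    split_ifs <;> simp
  have habs := (le_abs_self _).trans hi
  obtain ⟨i, hik⟩ := i
  cases i with
  | zero =>
    simp only [Nat.add_eq_zero_iff, one_ne_zero, and_false, if_false, Finset.sum_const_zero] at *
    linarith
  | succ i =>
    simp only [Nat.add_right_cancel_iff, Finset.sum_ite_eq'] at *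
    have := h i (by omega)
    rw [if_pos (Finset.mem_range.2 (by omega : i < k + 1))] at hsum
    linarith

theorem dotProduct_mulVec_le_maxEig {m : ℕ} {M : Matrix (Fin m) (Fin m) ℝ} (hM : M.IsHermitian)
    (v : Fin m → ℝ) : v ⬝ᵥ M.mulVec v ≤ maxEig M * (v ⬝ᵥ v) := by
  have hbdd : BddAbove {μ : ℝ | Module.End.HasEigenvalue (Matrix.toLin' M) μ} :=
    (Module.End.finite_hasEigenvalue _).bddAbove
  have hN : (Matrix.scalar (Fin m) (maxEig M) - M).IsHermitian := by
    refine Matrix.IsHermitian.sub ?_ hM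
    simp [Matrix.IsHermitian]
  have hpos : (Matrix.scalar (Fin m) (maxEig M) - M).PosSemidef := by
    rw [hN.posSemidef_iff_eigenvalues_nonneg]
    intro i
    have hmul := hN.mulVec_eigenvectorBasis i
    have hne : (hN.eigenvectorBasis i).ofLp ≠ 0 := by
      simpa using hN.eigenvectorBasis.toBasis.ne_zero i
    have hev : Module.End.HasEigenvalue (Matrix.toLin' M) (maxEig M - hN.eigenvalues i) := by
      refine Module.End.hasEigenvalue_of_hasEigenvector
        (x := (hN.eigenvectorBasis i).ofLp) ⟨Module.End.mem_eigenspace_iff.2 ?_, hne⟩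
      rw [Matrix.sub_mulVec] at hmul
      rw [Matrix.toLin'_apply, sub_smul, ← hmul]
      simp [Matrix.scalar_apply, ← Matrix.smul_one_eq_diagonal, Matrix.smul_mulVec]
    have := le_csSup hbdd hev
    change _ ≤ maxEig M at this
    simpa using this
  have := hpos.dotProduct_mulVec_nonneg v
  rw [Matrix.sub_mulVec, dotProduct_sub] at this
  simp [Matrix.scalar_apply, ← Matrix.smul_one_eq_diagonal, Matrix.smul_mulVec] at this
  linarith

theorem dotProduct_Tridiag_mulVec (k : ℕ) (d o v : ℕ → ℝ) :
    (fun i : Fin (k + 1) => v i) ⬝ᵥ (Tridiag k d o).mulVec (fun i : Fin (k + 1) => v i) =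
      ∑ i ∈ Finset.range (k + 1), d i * v i ^ 2 +
        2 * ∑ i ∈ Finset.range k, o i * v i * v (i + 1) := by
  have hsplit : ∀ i j : Fin (k + 1), v i * (Tridiag k d o i j * v j) =
      (if (i : ℕ) = j then d i * v i ^ 2 else 0) +
      ((if (i : ℕ) + 1 = j then o i * v i * v (i + 1) else 0) +
       (if (j : ℕ) + 1 = i then o j * v j * v (j + 1) else 0)) := by
    intro i j
    simp only [Tridiag, Matrix.of_apply]
    split_ifs <;> grind
  have hshift : ∑ i ∈ Finset.range (k + 1), ∑ j ∈ Finset.range (k + 1),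
      (if i + 1 = j then o i * v i * v (i + 1) else 0) =
      ∑ i ∈ Finset.range k, o i * v i * v (i + 1) := by
    simp only [Finset.sum_ite_eq, Finset.mem_range, Nat.add_lt_add_iff_right]
    rw [Finset.sum_range_succ, if_neg (lt_irrefl k), add_zero]
    exact Finset.sum_congr rfl fun i hi => if_pos (Finset.mem_range.1 hi)
  simp only [dotProduct, Matrix.mulVec]
  simp only [Finset.mul_sum (Finset.univ : Finset (Fin (k + 1))), hsplit]
  rw [Finset.sum_congr rfl fun (i : Fin (k + 1)) _ => Fin.sum_univ_eq_sum_range (fun j =>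
      (if (i : ℕ) = j then d i * v i ^ 2 else 0) +
      ((if (i : ℕ) + 1 = j then o i * v i * v (i + 1) else 0) +
       (if j + 1 = (i : ℕ) then o j * v j * v (j + 1) else 0))) (k + 1),
    Fin.sum_univ_eq_sum_range (fun i => ∑ j ∈ Finset.range (k + 1),
      ((if i = j then d i * v i ^ 2 else 0) +
      ((if i + 1 = j then o i * v i * v (i + 1) else 0) +
       (if j + 1 = i then o j * v j * v (j + 1) else 0)))) (k + 1)]
  simp only [Finset.sum_add_distrib]
  rw [hshift, Finset.sum_comm (f := fun i j => if j + 1 = i then o j * v j * v (j + 1) else 0),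
    hshift, ← two_mul]
  congr 1
  refine Finset.sum_congr rfl fun i hi => ?_
  rw [Finset.sum_ite_eq, if_pos hi]

/-- Rayleigh bound with the indicator vector of the last `m + 1` coordinates. -/
theorem sum_le_maxEig_Tridiag {k m : ℕ} (hm : m ≤ k) (d o : ℕ → ℝ) :
    ∑ r ∈ Finset.range (m + 1), d (k - r) + 2 * ∑ r ∈ Finset.range m, o (k - (r + 1)) ≤
      maxEig (Tridiag k d o) * (m + 1) := by
  obtain ⟨v, hone, hzero⟩ : ∃ v : ℕ → ℝ, (∀ i, k ≤ i + m → v i = 1) ∧ ∀ i, i + m < k → v i = 0 :=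
    ⟨fun i => if k ≤ i + m then 1 else 0, fun i hi => if_pos hi, fun i hi => if_neg hi.not_ge⟩
  have h := dotProduct_mulVec_le_maxEig (Tridiag_isHermitian k d o) (fun i => v i)
  have hrefl : ∀ (f : ℕ → ℝ) (a b : ℕ), b ≤ a → (∀ r < a, b ≤ r → f (a - 1 - r) = 0) →
      ∑ i ∈ Finset.range a, f i = ∑ r ∈ Finset.range b, f (a - 1 - r) := by
    intro f a b hab hf
    rw [← Finset.sum_range_reflect]
    refine (Finset.sum_subset (Finset.range_subset_range.2 hab) fun r hr hr' => ?_).symm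
    exact hf r (Finset.mem_range.1 hr) (by simpa using hr')
  have hnorm : (fun i : Fin (k + 1) => v i) ⬝ᵥ (fun i : Fin (k + 1) => v i) = m + 1 := by
    rw [dotProduct, Fin.sum_univ_eq_sum_range (fun i => v i * v i),
      hrefl _ (k + 1) (m + 1) (by omega)
        fun r h1 h2 => by rw [hzero _ (by omega), mul_zero],
      Finset.sum_congr rfl (g := fun _ => (1 : ℝ)) fun r hr => ?_]
    · simp
    · have := Finset.mem_range.1 hr
      rw [hone _ (by omega), mul_one]
  rw [hnorm, dotProduct_Tridiag_mulVec,
    hrefl _ (k + 1) (m + 1) (by omega)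
      fun r h1 h2 => by rw [hzero _ (by omega)]; ring,
    hrefl _ k m hm fun r h1 h2 => by rw [hzero (k - 1 - r) (by omega)]; ring] at h
  refine (congrArg₂ (· + 2 * ·) (Finset.sum_congr rfl fun r hr => ?_)
    (Finset.sum_congr rfl fun r hr => ?_)).trans_le h
  · have := Finset.mem_range.1 hr
    rw [hone _ (by omega), one_pow, mul_one, Nat.add_sub_cancel]
  · have := Finset.mem_range.1 hr
    rw [hone _ (by omega), hone _ (by omega), mul_one, mul_one, Nat.sub_sub, add_comm 1 r]

theorem eventually_forall_hahn_row_lt {ω t c : ℝ} (ht0 : 0 ≤ t) (htω : t < ω) (hω : ω ≤ 1 / 2)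
    (hc : hahnLimit (ω * (1 - ω)) (Real.sqrt (t * (1 - t))) < c) :
    ∀ᶠ z : ℝ × ℝ in nhds (ω, 0), ∀ x ∈ Set.Icc 0 t,
      hahnDiag z.1 x z.2 + hahnOff z.1 x z.2 + hahnOff z.1 (x - z.2) z.2 < c := by
  have hω0 : 0 < ω := by linarith
  have hω1 : ω < 1 := by linarith
  refine isCompact_Icc.eventually_forall_of_forall_eventually fun x hx => ?_
  have hx2 : x < 1 / 2 := by linarith [hx.2]
  have hB := continuousAt_hahnDiag hω0 hω1 hx2
  have hA := continuousAt_hahnOff hω0 hω1 hx2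
  have e1 : Tendsto (fun z : (ℝ × ℝ) × ℝ => (z.1.1, z.2, z.1.2)) (nhds ((ω, 0), x))
      (nhds (ω, x, 0)) :=
    (show Continuous fun z : (ℝ × ℝ) × ℝ => (z.1.1, z.2, z.1.2) by fun_prop).tendsto _
  have e2 : Tendsto (fun z : (ℝ × ℝ) × ℝ => (z.1.1, z.2 - z.1.2, z.1.2)) (nhds ((ω, 0), x))
      (nhds (ω, x, 0)) := by
    simpa using (show Continuous fun z : (ℝ × ℝ) × ℝ => (z.1.1, z.2 - z.1.2, z.1.2) by
      fun_prop).tendsto ((ω, 0), x)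
  refine (((hB.tendsto.comp e1).add (hA.tendsto.comp e1)).add
    (hA.tendsto.comp e2)).eventually_lt_const ?_
  have hlim := hahnDiag_add_two_mul_hahnOff hω0 hω1 hx.1 hx2
  have hmono : hahnLimit (ω * (1 - ω)) (Real.sqrt (x * (1 - x))) ≤
      hahnLimit (ω * (1 - ω)) (Real.sqrt (t * (1 - t))) := by
    refine hahnLimit_le_hahnLimit (mul_pos hω0 (by linarith)) (Real.sqrt_nonneg _)
      (Real.sqrt_le_sqrt ?_)
    nlinarith [mul_nonneg (sub_nonneg.2 hx.2) (by linarith [hx.2] : 0 ≤ 1 - x - t)]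
  simp only
  linarith

/-- The Hahn tridiagonal matrix with parameters `N`, `W` and last index `k`. -/
noncomputable def hahnMatrix (N W : ℝ) (k : ℕ) : Matrix (Fin (k + 1)) (Fin (k + 1)) ℝ :=
  Tridiag k (fun i => hahnDiag (W / N) (i / N) (1 / N)) fun i => hahnOff (W / N) (i / N) (1 / N)

theorem maxEig_hahnMatrix_le {N W t c : ℝ} {k : ℕ} (hN : 0 < N) (hc : 0 ≤ c)
    (hkt : k / N ≤ t) (htW : t ≤ W / N) (htW' : t ≤ 1 - W / N)
    (hrow : ∀ x ∈ Set.Icc 0 t, hahnDiag (W / N) x (1 / N) + hahnOff (W / N) x (1 / N) +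
      hahnOff (W / N) (x - 1 / N) (1 / N) ≤ c) :
    maxEig (hahnMatrix N W k) ≤ c := by
  have ht : 0 ≤ t := (by positivity : 0 ≤ (k : ℝ) / N).trans hkt
  have hx : ∀ i : ℕ, i ≤ k → (i : ℝ) / N ∈ Set.Icc 0 t := fun i hi =>
    ⟨by positivity, (div_le_div_of_nonneg_right (Nat.cast_le.2 hi) hN.le).trans hkt⟩
  have habs : ∀ i : ℕ, i ≤ k → |hahnOff (W / N) (i / N) (1 / N)| =
      hahnOff (W / N) (i / N) (1 / N) := fun i hi =>
    abs_of_nonneg (hahnOff_nonneg ((hx i hi).2.trans htW) ((hx i hi).2.trans htW')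
      (by linarith) (by linarith))
  refine Real.sSup_le (fun μ hμ => hasEigenvalue_Tridiag_le ?_ (fun i hi => ?_) hμ) hc
  · rw [habs 0 (Nat.zero_le k)]
    have h := hrow _ (hx 0 (Nat.zero_le k))
    rw [Nat.cast_zero, zero_div, zero_sub, hahnOff_neg_step, add_zero] at h
    simpa using h
  · rw [habs _ hi, habs _ hi.le]
    have h := hrow _ (hx (i + 1) hi)
    have e : ((i + 1 : ℕ) : ℝ) / N - 1 / N = i / N := by push_cast; ring
    rwa [e] at h

theorem tendsto_maxEig_hahnMatrix {ω τ : ℝ} (hτ0 : 0 < τ) (hτω : τ < ω) (hω : ω ≤ 1 / 2)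
    {n w k : ℕ → ℕ} (hn : Tendsto n atTop atTop)
    (hw : Tendsto (fun j => (w j : ℝ) / (n j : ℝ)) atTop (nhds ω))
    (hk : Tendsto (fun j => (k j : ℝ) / (n j : ℝ)) atTop (nhds τ)) :
    Tendsto (fun j => maxEig (hahnMatrix (n j) (w j) (k j))) atTop
      (nhds (hahnLimit (ω * (1 - ω)) (Real.sqrt (τ * (1 - τ))))) := by
  have hω0 : 0 < ω := hτ0.trans hτω
  have hω1 : ω < 1 := by linarith
  have hτ2 : τ < 1 / 2 := by linarith
  have hq : 0 < ω * (1 - ω) := mul_pos hω0 (by linarith)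
  have hnR : Tendsto (fun j => (n j : ℝ)) atTop atTop := tendsto_natCast_atTop_atTop.comp hn
  have hinv : Tendsto (fun j => 1 / (n j : ℝ)) atTop (nhds 0) := by
    exact tendsto_const_nhds.div_atTop hnR
  have hnpos : ∀ᶠ j in atTop, 0 < (n j : ℝ) := hnR.eventually_gt_atTop 0
  have hkatTop : Tendsto k atTop atTop := by
    rw [← tendsto_natCast_atTop_iff (R := ℝ)]
    refine (hk.pos_mul_atTop hτ0 hnR).congr' ?_
    filter_upwards [hnpos] with j hj
    field_simp
  refine tendsto_order.2 ⟨fun c hc => ?_, fun c hc => ?_⟩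
  · rw [← hahnDiag_add_two_mul_hahnOff hω0 hω1 hτ0.le hτ2] at hc
    obtain ⟨m, hm⟩ := exists_nat_gt
      (2 * hahnOff ω τ 0 / (hahnDiag ω τ 0 + 2 * hahnOff ω τ 0 - c))
    rw [div_lt_iff₀ (by linarith)] at hm
    have hz : ∀ r : ℕ, Tendsto (fun j => ((w j : ℝ) / n j, ((k j - r : ℕ) : ℝ) / n j,
        1 / (n j : ℝ))) atTop (nhds (ω, τ, 0)) := by
      intro r
      refine hw.prodMk_nhds (Tendsto.prodMk_nhds ?_ hinv)
      have h := hk.sub (hinv.const_mul (r : ℝ))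
      rw [mul_zero, sub_zero] at h
      refine h.congr' ?_
      filter_upwards [hkatTop.eventually_ge_atTop r] with j hj
      rw [Nat.cast_sub hj]
      ring
    have hsum := (tendsto_finsetSum (Finset.range (m + 1)) fun r _ =>
      (continuousAt_hahnDiag hω0 hω1 hτ2).tendsto.comp (hz r)).add
        ((tendsto_finsetSum (Finset.range m) fun r _ =>
          (continuousAt_hahnOff hω0 hω1 hτ2).tendsto.comp (hz (r + 1))).const_mul 2)
    have hlt : c * (m + 1) < ∑ _r ∈ Finset.range (m + 1), hahnDiag ω τ 0 +
        2 * ∑ _r ∈ Finset.range m, hahnOff ω τ 0 := by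
      simp only [Finset.sum_const, Finset.card_range, nsmul_eq_mul, Nat.cast_add, Nat.cast_one]
      nlinarith
    filter_upwards [hsum.eventually_const_lt hlt, hkatTop.eventually_ge_atTop m] with j h1 h2
    have h3 := sum_le_maxEig_Tridiag h2
      (fun i => hahnDiag (w j / n j) (i / n j) (1 / n j))
      (fun i => hahnOff (w j / n j) (i / n j) (1 / n j))
    exact lt_of_mul_lt_mul_right (h1.trans_le h3) (by positivity)
  · have hcont : ContinuousAt
        (fun t => hahnLimit (ω * (1 - ω)) (Real.sqrt (t * (1 - t)))) τ :=
      ContinuousAt.comp (f := fun t => Real.sqrt (t * (1 - t)))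
        (continuousAt_hahnLimit hq (Real.sqrt_nonneg _)) (by fun_prop)
    obtain ⟨t, ⟨htc, htω⟩, hτt⟩ := ((((hcont.eventually_lt_const hc).and
      (eventually_lt_nhds hτω)).filter_mono nhdsWithin_le_nhds).and
        (self_mem_nhdsWithin (s := Set.Ioi τ))).exists
    obtain ⟨c', hc', hc'c⟩ := exists_between htc
    have hrow := (hw.prodMk_nhds hinv).eventually
      (eventually_forall_hahn_row_lt (hτ0.trans hτt).le htω hω hc')
    filter_upwards [hrow, hnpos, hk.eventually_lt_const hτt, hw.eventually_const_lt htω,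
      hw.eventually_lt_const (by linarith : ω < 1 - t)] with j h1 h2 h3 h4 h5
    refine (maxEig_hahnMatrix_le h2 ?_ h3.le h4.le (by linarith) fun x hx => (h1 x hx).le).trans_lt
      hc'c
    exact (hahnLimit_nonneg hq (Real.sqrt_nonneg _)).trans hc'.le

/-- Lemma 4: the limit of the largest eigenvalue of the Hahn tridiagonal matrix
when `w/n → ω` and `k/n → τ`. -/
theorem hahn_maxEig_limit (ω τ : ℝ) (hτ0 : 0 < τ) (hτω : τ < ω) (hω : ω ≤ 1 / 2)
    (n w k : ℕ → ℕ) (hnpos : ∀ j, 0 < n j) (hwpos : ∀ j, 0 < w j) (hkpos : ∀ j, 0 < k j)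
    (hn : Tendsto n atTop atTop)
    (hw : Tendsto (fun j => (w j : ℝ) / (n j : ℝ)) atTop (nhds ω))
    (hk : Tendsto (fun j => (k j : ℝ) / (n j : ℝ)) atTop (nhds τ))
    (aH bH : ℕ → ℕ → ℝ)
    (haH : aH = fun j (i : ℕ) => ((n j : ℝ) * ((w j : ℝ) - i) * ((n j : ℝ) - w j - i)
        / ((w j : ℝ) * ((n j : ℝ) - w j) * ((n j : ℝ) - 2 * i)))
      * Real.sqrt ((((i : ℝ) + 1) * ((n j : ℝ) - i + 1))
        / (((n j : ℝ) - 2 * i + 1) * ((n j : ℝ) - 2 * i - 1))))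
    (hbH : bH = fun j (i : ℕ) => ((n j : ℝ) - 2 * w j) ^ 2 * (i : ℝ) * ((n j : ℝ) - i + 1)
      / ((w j : ℝ) * ((n j : ℝ) - w j) * ((n j : ℝ) - 2 * i) * ((n j : ℝ) - 2 * i + 2))) :
    Tendsto (fun j => maxEig (Tridiag (k j) (bH j) (aH j))) atTop
      (nhds (Real.sqrt (τ * (1 - τ)) * (2 * ω * (1 - ω) + Real.sqrt (τ * (1 - τ)))
        / (ω * (1 - ω) * (1 + 2 * Real.sqrt (τ * (1 - τ)))))) := by
  subst haH hbH
  have h := tendsto_maxEig_hahnMatrix hτ0 hτω hω hn hw hk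
  rw [hahnLimit, ← mul_assoc] at h
  refine h.congr fun j => ?_
  have hj : (n j : ℝ) ≠ 0 := Nat.cast_ne_zero.2 (hnpos j).ne'
  simp only [hahnMatrix, hahnDiag_div hj, hahnOff_div hj]
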